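/- arXiv:0705.3294 — 2 statements merged into one kernel-verified Lean document; each statement's English description precedes it below -/
import Mathlib

section
/- Let c ∈ ℝ and θ₀ ∈ (0, 1), and define θ : ℝ → ℝ by θ(t) = 1/2 − (1/π)·arctan(cot(πθ₀) − c·t). Then θ(0) = θ₀, θ(t) ∈ (0, 1) for all t, and θ is differentiable with θ′(t) = c·(1 − cos(2πθ(t)))/(2π) for all t. In other words, in the coordinate u = cot(πθ), the phase equation θ̇ = c·z(θ) with z(θ) = (1 − cos(2πθ))/(2π) becomes the linear equation u̇ = −c. -/
open Real

/-- For c ∈ ℝ and θ₀ ∈ (0, 1), the function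
θ(t) = 1/2 − (1/π)·arctan(cot(πθ₀) − c·t) satisfies θ(0) = θ₀, θ(t) ∈ (0, 1) for all t,
and θ′(t) = c·(1 − cos(2πθ(t)))/(2π) for all t: in the coordinate u = cot(πθ) the phase
equation θ̇ = c·z(θ) with z(θ) = (1 − cos(2πθ))/(2π) becomes u̇ = −c. -/
theorem stmt_16 (c θ₀ : ℝ) (hθ₀ : θ₀ ∈ Set.Ioo (0 : ℝ) 1)
    (θ : ℝ → ℝ)
    (hθ : ∀ t : ℝ, θ t = 1 / 2 - (1 / π) * Real.arctan (Real.cot (π * θ₀) - c * t)) :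
    θ 0 = θ₀ ∧
    (∀ t : ℝ, θ t ∈ Set.Ioo (0 : ℝ) 1) ∧
    (∀ t : ℝ, HasDerivAt θ (c * (1 - Real.cos (2 * π * θ t)) / (2 * π)) t) := by
  obtain ⟨h0, h1⟩ := hθ₀
  have hpi := Real.pi_pos
  refine ⟨?_, ?_, ?_⟩
  · have hcot : Real.cot (π * θ₀) = Real.tan (π / 2 - π * θ₀) := by
      rw [Real.tan_eq_sin_div_cos, Real.sin_pi_div_two_sub, Real.cos_pi_div_two_sub,
        Real.cot_eq_cos_div_sin]
    rw [hθ 0, mul_zero, sub_zero, hcot, Real.arctan_tan (by nlinarith) (by nlinarith)]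
    field_simp
    ring
  · intro t
    rw [hθ t]
    have ha := Real.neg_pi_div_two_lt_arctan (Real.cot (π * θ₀) - c * t)
    have hb := Real.arctan_lt_pi_div_two (Real.cot (π * θ₀) - c * t)
    generalize Real.arctan (Real.cot (π * θ₀) - c * t) = a at ha hb
    have e : 1 / π * a = a / π := by ring
    have h3 : a / π < 1 / 2 := by rw [div_lt_iff₀ hpi]; linarith
    have h4 : -(1 / 2) < a / π := by rw [lt_div_iff₀ hpi]; linarith
    rw [e]
    constructor <;> linarith
  · intro t
    have hfun : θ = fun t => 1 / 2 - (1 / π) * Real.arctan (Real.cot (π * θ₀) - c * t) :=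
      funext hθ
    have hd : HasDerivAt (fun t : ℝ => Real.cot (π * θ₀) - c * t) (-(c * 1)) t :=
      ((hasDerivAt_id t).const_mul c).const_sub _
    have hD := (hd.arctan.const_mul (1 / π)).const_sub (1 / 2)
    rw [← hfun] at hD
    refine hD.congr_deriv (Eq.symm ?_)
    have hang : 2 * π * θ t = π - 2 * Real.arctan (Real.cot (π * θ₀) - c * t) := by
      rw [hθ t]
      field_simp
    rw [hang, Real.cos_pi_sub, Real.cos_two_mul, Real.cos_sq_arctan]
    field_simp
    ring
end

section
/- Let A > 0, θ₀ ∈ (0, 1), and ε > 0. If θ : [0, ε] → ℝ is differentiable with θ(0) = θ₀ and θ′(t) = (A/ε)·(1 − cos(2πθ(t)))/(2π) for all t ∈ [0, ε], then θ(ε) = 1/2 − (1/π)·arctan(cot(πθ₀) − A). In particular, the time-ε solution map κ_ε(ε) of the spread-out kick is independent of ε, so the kick map κ = lim_{ε→0} κ_ε(ε) of the forced oscillator model exists and is given in the coordinate u = cot(πθ) by u ↦ u − A. -/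
open Real

/-- If θ solves θ′ = (A/ε)·(1 − cos(2πθ))/(2π) on [0, ε] with
θ(0) = θ₀ ∈ (0, 1), then θ(ε) = 1/2 − (1/π)·arctan(cot(πθ₀) − A).  In particular the
time-ε solution map of the spread-out kick is independent of ε, so the kick map
κ = lim_{ε→0} κ_ε(ε) of the forced oscillator model exists and is given in the coordinate
u = cot(πθ) by u ↦ u − A. -/
theorem stmt_17 (A θ₀ ε : ℝ) (hA : 0 < A) (hθ₀ : θ₀ ∈ Set.Ioo (0 : ℝ) 1) (hε : 0 < ε)
    (θ : ℝ → ℝ) (h0 : θ 0 = θ₀)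
    (hθ' : ∀ t ∈ Set.Icc (0 : ℝ) ε,
      HasDerivAt θ ((A / ε) * (1 - Real.cos (2 * π * θ t)) / (2 * π)) t) :
    θ ε = 1 / 2 - (1 / π) * Real.arctan (Real.cot (π * θ₀) - A) := by
  have hpi := Real.pi_pos
  have hpi0 : π ≠ 0 := hpi.ne'
  set c := Real.cot (π * θ₀) with hc
  let ψ : ℝ → ℝ := fun t => 1 / 2 - (1 / π) * Real.arctan (c - A / ε * t)
  let v : ℝ → ℝ := fun x => (A / ε) * (1 - Real.cos (2 * π * x)) / (2 * π)
  have hAε : 0 < A / ε := div_pos hA hε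
  have hv : ∀ x, HasDerivAt v (A / ε * Real.sin (2 * π * x)) x := by
    intro x
    have h1 : HasDerivAt (fun x : ℝ => 2 * π * x) (2 * π) x := by
      simpa using (hasDerivAt_id x).const_mul (2 * π)
    have h2 := ((h1.cos.const_sub 1).const_mul (A / ε)).div_const (2 * π)
    refine HasDerivAt.congr_deriv (f := v) h2 ?_
    field_simp
    try ring
  have hL : LipschitzWith (Real.toNNReal (A / ε)) v := by
    apply lipschitzWith_of_nnnorm_deriv_le (fun x => (hv x).differentiableAt)
    intro x
    rw [← NNReal.coe_le_coe, coe_nnnorm, (hv x).deriv, Real.coe_toNNReal _ hAε.le,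
      Real.norm_eq_abs, abs_mul, abs_of_pos hAε]
    exact mul_le_of_le_one_right hAε.le (Real.abs_sin_le_one _)
  have hψ : ∀ t, HasDerivAt ψ (v (ψ t)) t := by
    intro t
    have h1 : HasDerivAt (fun t : ℝ => c - A / ε * t) (-(A / ε)) t := by
      simpa using ((hasDerivAt_id t).const_mul (A / ε)).const_sub c
    have h2 := (h1.arctan.const_mul (1 / π)).const_sub (1 / 2)
    refine HasDerivAt.congr_deriv (f := ψ) h2 ?_
    have h3 : 2 * π * ψ t = π - 2 * Real.arctan (c - A / ε * t) := by
      simp only [ψ]; field_simp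
    have h4 := Real.cos_sq_arctan (c - A / ε * t)
    simp only [v]
    rw [h3, Real.cos_pi_sub, Real.cos_two_mul, h4]
    generalize 1 / (1 + (c - A / ε * t) ^ 2) = w
    field_simp
    ring
  have hψ0 : ψ 0 = θ₀ := by
    have : Real.arctan c = π / 2 - π * θ₀ := by
      rw [hc, Real.cot_eq_cos_div_sin, ← Real.sin_pi_div_two_sub (π * θ₀), ← Real.cos_pi_div_two_sub (π * θ₀),
        ← Real.tan_eq_sin_div_cos]
      apply Real.arctan_tan
      · nlinarith [hθ₀.2]
      · nlinarith [hθ₀.1]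
    simp only [ψ, mul_zero, sub_zero, this]
    field_simp
    ring
  have key : Set.EqOn θ ψ (Set.Icc 0 ε) := by
    apply ODE_solution_unique (v := fun _ => v) (K := Real.toNNReal (A / ε)) (fun _ => hL)
    · exact fun t ht => (hθ' t ht).continuousAt.continuousWithinAt
    · exact fun t ht => (hθ' t ⟨ht.1, ht.2.le⟩).hasDerivWithinAt
    · exact fun t _ => (hψ t).continuousAt.continuousWithinAt
    · exact fun t _ => (hψ t).hasDerivWithinAt
    · rw [h0, hψ0]
  have := key (Set.right_mem_Icc.2 hε.le)
  rw [this]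
  simp only [ψ]
  rw [div_mul_cancel₀ _ hε.ne']
end
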